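/- Let V and W be compact subsets of ℝ² that are closures of bounded simply connected open sets, and suppose W is convex. Let F = (u, v) : V → ℝ² where u and v are continuous on V, continuously differentiable on the interior of V, and harmonic on the interior of V. Suppose the restriction of F to ∂V is an orientation-preserving homeomorphism from ∂V onto ∂W. Then F is a bijection from V onto W. -/

import Mathlib

open Set Filter Topology

/-- The Laplacian `∂²u/∂x² + ∂²u/∂y²` of a function `u : ℝ² → ℝ` at a point `p`. -/
noncomputable def lap2 (u : ℝ × ℝ → ℝ) (p : ℝ × ℝ) : ℝ :=
  fderiv ℝ (fun q => fderiv ℝ u q (1, 0)) p (1, 0) +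
  fderiv ℝ (fun q => fderiv ℝ u q (0, 1)) p (0, 1)

/-- `u` is harmonic on `Ω ⊆ ℝ²`: twice continuously differentiable with vanishing Laplacian. -/
def HarmonicOn2 (u : ℝ × ℝ → ℝ) (Ω : Set (ℝ × ℝ)) : Prop :=
  ContDiffOn ℝ 2 u Ω ∧ ∀ p ∈ Ω, lap2 u p = 0

/-- The 1-periodic loop `γ` winds once counterclockwise around the point `z`: it admits a
continuous polar-coordinate representation around `z` whose angle increases by `2π`
over one period. -/
def WindsCCWAround (γ : ℝ → ℝ × ℝ) (z : ℝ × ℝ) : Prop :=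
  ∃ r θ : ℝ → ℝ, Continuous r ∧ Continuous θ ∧ (∀ t, 0 < r t) ∧
    (∀ t, γ t - z = (r t * Real.cos (θ t), r t * Real.sin (θ t))) ∧
    (∀ t, θ (t + 1) = θ t + 2 * Real.pi)

/-- `γ` is a counterclockwise Jordan parametrization of the boundary of `V`: a 1-periodic
continuous loop, injective on a period, whose image is `frontier V`, and which winds once
counterclockwise around every interior point of `V`. -/
def IsCCWBoundaryParam (γ : ℝ → ℝ × ℝ) (V : Set (ℝ × ℝ)) : Prop :=
  Continuous γ ∧ (∀ t, γ (t + 1) = γ t) ∧ InjOn γ (Ico (0 : ℝ) 1) ∧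
  γ '' Ico (0 : ℝ) 1 = frontier V ∧ ∀ z ∈ interior V, WindsCCWAround γ z

/-- `V` is the closure of a bounded, nonempty, simply connected open subset of `ℝ²`. -/
def IsClosureOfSCRegion (V : Set (ℝ × ℝ)) : Prop :=
  ∃ Ω : Set (ℝ × ℝ), IsOpen Ω ∧ Bornology.IsBounded Ω ∧ Ω.Nonempty ∧
    SimplyConnectedSpace Ω ∧ V = closure Ω

/-- The restriction of `F` to the boundary of `V` is an orientation-preserving homeomorphism
from `∂V` onto `∂W`: some counterclockwise Jordan parametrization of `∂V` is carried by `F`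
to a counterclockwise Jordan parametrization of `∂W`. -/
def OrientPresBoundaryHomeo (F : ℝ × ℝ → ℝ × ℝ) (V W : Set (ℝ × ℝ)) : Prop :=
  ∃ γ : ℝ → ℝ × ℝ, IsCCWBoundaryParam γ V ∧ IsCCWBoundaryParam (F ∘ γ) W

section Crossing

open Complex

theorem Complex.exists_continuousMap_exp_eq (f : C(unitInterval × unitInterval, ℂ))
    (hf : ∀ x, f x ≠ 0) : ∃ L : C(unitInterval × unitInterval, ℂ), ∀ x, exp (L x) = f x := by
  let π : C(ℝ, unitInterval) := ⟨projIcc 0 1 zero_le_one, continuous_projIcc⟩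
  obtain ⟨L, ⟨-, hL⟩, -⟩ := isCoveringMapOn_exp.existsUnique_continuousMap_lifts
    (f.comp (π.prodMap π)) (a₀ := 0) (e₀ := log (f (π 0, π 0))) (exp_log (hf _)) (fun _ ↦ hf _)
  refine ⟨L.comp ⟨fun x ↦ (x.1, x.2), by fun_prop⟩, fun x ↦ ?_⟩
  simpa [π] using congr_fun hL (x.1, x.2)

theorem Complex.sub_eq_sub_of_exp_eq {A : Type*} [TopologicalSpace A] [PreconnectedSpace A]
    {L M : A → ℂ} (hL : Continuous L) (hM : Continuous M) (h : ∀ a, exp (L a) = exp (M a))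
    (a b : A) : L b - L a = M b - M a := by
  have key : L = fun x ↦ M x + (L a - M a) := by
    refine isCoveringMap_exp.eq_of_comp_eq hL (by fun_prop) ?_ a (by simp)
    ext x
    simp [Complex.exp_add, Complex.exp_sub, h, exp_ne_zero]
  have := congr_fun key b
  rw [this]; ring

theorem Complex.one_sub_smul_div_mem_slitPlane {a b : ℂ}
    (h : ∀ r : unitInterval, a ≠ (r : ℝ) * b) (r : unitInterval) :
    1 - (r : ℝ) * b / a ∈ slitPlane := by
  have ha : a ≠ 0 := by simpa using h 0
  by_contra hc
  rw [mem_slitPlane_iff_not_le_zero, not_not, Complex.le_def] at hc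
  obtain ⟨h1, h2⟩ := hc
  obtain ⟨x, hx⟩ : ∃ x : ℝ, (r : ℝ) * b / a = x :=
    ⟨((r : ℝ) * b / a).re, Complex.ext (by simp) (by simpa using h2)⟩
  rw [hx] at h1
  simp at h1
  have hx0 : (x : ℂ) ≠ 0 := by exact_mod_cast (by linarith : (0 : ℝ) < x).ne'
  refine h ⟨r * x⁻¹, mul_nonneg r.2.1 (by positivity),
    mul_le_one₀ r.2.2 (by positivity) (inv_le_one_of_one_le₀ h1)⟩ ?_
  rw [div_eq_iff ha] at hx
  push_cast
  rw [mul_right_comm, hx]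
  field_simp

/-- Comparison of the variation of the argument along a path `α` as seen from `0` and from `b`,
when `α` avoids the segment `[0, b]`. -/
theorem Complex.log_variation_sub {α : C(unitInterval, ℂ)} {b : ℂ}
    (h : ∀ s r : unitInterval, α s ≠ (r : ℝ) * b)
    {L M : unitInterval → ℂ} (hL : Continuous L) (hM : Continuous M)
    (hLe : ∀ s, exp (L s) = α s - b) (hMe : ∀ s, exp (M s) = α s) :
    (L 1 - L 0) - (M 1 - M 0) = log (1 - b / α 1) - log (1 - b / α 0) := by
  obtain ⟨K, hK⟩ := exists_continuousMap_exp_eq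
    (⟨fun x : unitInterval × unitInterval ↦ α x.1 - ((x.2 : ℝ) : ℂ) * b, by fun_prop⟩ :
      C(unitInterval × unitInterval, ℂ))
    (fun x ↦ sub_ne_zero.2 (h x.1 x.2))
  simp only [ContinuousMap.coe_mk] at hK
  have side : ∀ s : unitInterval, K (s, 1) - K (s, 0) = log (1 - b / α s) := by
    intro s
    have ha : α s ≠ 0 := by simpa using h s 0
    have hm := fun r ↦ one_sub_smul_div_mem_slitPlane (h s) r
    have := sub_eq_sub_of_exp_eq (L := fun r : unitInterval ↦ K (s, r))
      (M := fun r : unitInterval ↦ K (s, 0) + log (1 - ((r : ℝ) : ℂ) * b / α s)) (by fun_prop)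
      (continuous_const.add (Continuous.clog (by fun_prop) hm)) (fun r ↦ by
        rw [exp_add, exp_log (slitPlane_ne_zero (hm r)), hK, hK]
        simp
        field_simp) 0 1
    simpa using this
  have h1 := sub_eq_sub_of_exp_eq (L := L) (M := fun s ↦ K (s, 1)) hL (by fun_prop)
    (fun s ↦ by simp [hK, hLe]) 0 1
  have h0 := sub_eq_sub_of_exp_eq (L := M) (M := fun s ↦ K (s, 0)) hM (by fun_prop)
    (fun s ↦ by simp [hK, hMe]) 0 1
  rw [h1, h0, ← side, ← side]
  ring

theorem Complex.arg_one_sub_exp {φ : ℝ} (h0 : 0 < φ) (h1 : φ < 2 * Real.pi) :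
    arg (1 - exp (φ * I)) = (φ - Real.pi) / 2 := by
  have hs : 0 < 2 * Real.sin (φ / 2) :=
    mul_pos two_pos (Real.sin_pos_of_pos_of_lt_pi (by linarith) (by linarith))
  rw [← arg_mul_cos_add_sin_mul_I hs (θ := (φ - Real.pi) / 2)
    ⟨by linarith [Real.pi_pos], by linarith [Real.pi_pos]⟩]
  congr 1
  have e : (φ - Real.pi) / 2 = φ / 2 - Real.pi / 2 := by ring
  have h2 : (φ : ℂ) = 2 * (φ / 2) := by ring
  rw [e, ofReal_sub, ofReal_div, ofReal_div, ofReal_ofNat, Complex.cos_sub_pi_div_two,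
    Complex.sin_sub_pi_div_two, exp_mul_I]
  conv_lhs => rw [h2, Complex.cos_two_mul, Complex.sin_two_mul]
  push_cast
  linear_combination -2 * Complex.sin_sq_add_cos_sq (φ / 2 : ℂ)

theorem Complex.arg_one_sub_exp_neg {φ : ℝ} (h0 : 0 < φ) (h1 : φ < 2 * Real.pi) :
    arg (1 - exp (-φ * I)) = (Real.pi - φ) / 2 := by
  have := arg_one_sub_exp (φ := 2 * Real.pi - φ) (by linarith) (by linarith)
  rw [show (((2 * Real.pi - φ : ℝ) : ℂ)) * I = -φ * I + 2 * Real.pi * I by push_cast; ring,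
    exp_add, exp_two_pi_mul_I, mul_one] at this
  rw [this]; ring

/-- Two paths in the plane whose endpoints interleave on a circle around the origin, and which
both avoid the radii of the circle leading to the endpoints of the other one, must meet. -/
theorem Complex.exists_eq_of_interleaved {r θ₁ θ₂ θ₃ θ₄ : ℝ} (hr : 0 < r) (h₁₂ : θ₁ < θ₂)
    (h₂₃ : θ₂ < θ₃) (h₃₄ : θ₃ < θ₄) (h₄₁ : θ₄ < θ₁ + 2 * Real.pi)
    (α : Path (r * exp (θ₁ * I)) (r * exp (θ₃ * I)))
    (β : Path (r * exp (θ₂ * I)) (r * exp (θ₄ * I)))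
    (hα₂ : ∀ s x : unitInterval, α s ≠ (x : ℝ) * (r * exp (θ₂ * I)))
    (hα₄ : ∀ s x : unitInterval, α s ≠ (x : ℝ) * (r * exp (θ₄ * I)))
    (hβ₁ : ∀ s x : unitInterval, β s ≠ (x : ℝ) * (r * exp (θ₁ * I)))
    (hβ₃ : ∀ s x : unitInterval, β s ≠ (x : ℝ) * (r * exp (θ₃ * I))) :
    ∃ s t, α s = β t := by
  by_contra! hne
  obtain ⟨K, hK⟩ := exists_continuousMap_exp_eq
    (⟨fun x : unitInterval × unitInterval ↦ α x.1 - β x.2, by fun_prop⟩ :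
      C(unitInterval × unitInterval, ℂ))
    (fun x ↦ sub_ne_zero.2 (hne x.1 x.2))
  simp only [ContinuousMap.coe_mk] at hK
  obtain ⟨M, hM⟩ := exists_continuousMap_exp_eq (α.toContinuousMap.comp .fst)
    (fun s ↦ by simpa using hα₂ s.1 0)
  obtain ⟨N, hN⟩ := exists_continuousMap_exp_eq (β.toContinuousMap.comp .fst)
    (fun s ↦ by simpa using hβ₁ s.1 0)
  have e₂ := log_variation_sub (α := α.toContinuousMap) hα₂ (L := fun s ↦ K (s, 0))
    (M := fun s ↦ M (s, 0)) (by fun_prop) (by fun_prop) (fun s ↦ by simp [hK]) (fun s ↦ hM (s, 0))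
  have e₄ := log_variation_sub (α := α.toContinuousMap) hα₄ (L := fun s ↦ K (s, 1))
    (M := fun s ↦ M (s, 0)) (by fun_prop) (by fun_prop) (fun s ↦ by simp [hK]) (fun s ↦ hM (s, 0))
  have e₁ := log_variation_sub (α := β.toContinuousMap) hβ₁
    (L := fun s ↦ K (0, s) + Real.pi * I)
    (M := fun s ↦ N (s, 0)) (by fun_prop) (by fun_prop) (fun s ↦ by simp [hK, exp_add])
    (fun s ↦ hN (s, 0))
  have e₃ := log_variation_sub (α := β.toContinuousMap) hβ₃
    (L := fun s ↦ K (1, s) + Real.pi * I)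
    (M := fun s ↦ N (s, 0)) (by fun_prop) (by fun_prop) (fun s ↦ by simp [hK, exp_add])
    (fun s ↦ hN (s, 0))
  have quot : ∀ x y : ℝ, (r * exp (x * I)) / (r * exp (y * I)) = exp ((x - y : ℝ) * I) := by
    intro x y
    have : (r : ℂ) ≠ 0 := by exact_mod_cast hr.ne'
    rw [mul_div_mul_left _ _ this, ← exp_sub]
    push_cast
    ring_nf
  have pos : ∀ x y : ℝ, y < x → x < y + 2 * Real.pi →
      (log (1 - r * exp (x * I) / (r * exp (y * I)))).im = (x - y - Real.pi) / 2 := by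
    intro x y h1 h2
    rw [quot, log_im, arg_one_sub_exp (by linarith) (by linarith)]
  have neg : ∀ x y : ℝ, x < y → y < x + 2 * Real.pi →
      (log (1 - r * exp (x * I) / (r * exp (y * I)))).im = (Real.pi - (y - x)) / 2 := by
    intro x y h1 h2
    rw [quot, log_im, ← arg_one_sub_exp_neg (by linarith) (by linarith)]
    push_cast
    ring_nf
  simp only [Path.coe_toContinuousMap, Path.source, Path.target] at e₁ e₂ e₃ e₄
  have e := congr_arg im (congr_arg₂ (· - ·) (congr_arg₂ (· - ·) e₄ e₂) (congr_arg₂ (· - ·) e₃ e₁))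
  simp only [sub_im, add_im] at e
  rw [pos θ₄ θ₃, pos θ₄ θ₁, neg θ₂ θ₃, pos θ₂ θ₁, neg θ₃ θ₄, pos θ₃ θ₂, neg θ₁ θ₄, neg θ₁ θ₂] at e
  · linarith [Real.pi_pos]
  all_goals linarith

end Crossing

section HarmonicPlane

open Complex InnerProductSpace

theorem InnerProductSpace.HarmonicAt.exists_analyticAt_re_eq {h : ℂ → ℝ} {p : ℂ}
    (hh : HarmonicAt h p) : ∃ g : ℂ → ℂ, AnalyticAt ℂ g p ∧ (fun z ↦ (g z).re) =ᶠ[𝓝 p] h := by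
  obtain ⟨ε, h₁ε, h₂ε⟩ := Metric.isOpen_iff.1 (isOpen_setOfPred_harmonicAt (f := h)) p hh
  obtain ⟨g, hg, hgh⟩ := HarmonicOnNhd.exists_analyticOnNhd_ball_re_eq (fun _ hy ↦ h₂ε hy)
  exact ⟨g, hg p (Metric.mem_ball_self h₁ε), hgh.eventuallyEq_of_mem (Metric.ball_mem_nhds p h₁ε)⟩

theorem InnerProductSpace.HarmonicAt.eventually_eq_of_isLocalMax {h : ℂ → ℝ} {p : ℂ}
    (hh : HarmonicAt h p) (hm : IsLocalMax h p) : ∀ᶠ z in 𝓝 p, h z = h p := by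
  obtain ⟨g, hg, hgh⟩ := hh.exists_analyticAt_re_eq
  have hd : ∀ᶠ z in 𝓝 p, DifferentiableAt ℂ (fun z ↦ exp (g z)) z :=
    hg.eventually_analyticAt.mono fun z hz ↦ hz.differentiableAt.cexp
  have hl : IsLocalMax (norm ∘ fun z ↦ exp (g z)) p := by
    filter_upwards [hgh, hm] with z hz hz'
    simp only [Function.comp, norm_exp, Real.exp_le_exp]
    simpa [hz, hgh.eq_of_nhds] using hz'
  filter_upwards [hgh, eventually_eq_of_isLocalMax_norm hd hl] with z hz hz'
  have := congr_arg norm hz'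
  rw [norm_exp, norm_exp, Real.exp_eq_exp] at this
  rw [← hz, ← hgh.eq_of_nhds, this]

theorem InnerProductSpace.HarmonicOnNhd.eqOn_const_of_eventually_eq {h : ℂ → ℝ} {U : Set ℂ}
    (hh : HarmonicOnNhd h U) (hU : IsPreconnected U) {p : ℂ} (hp : p ∈ U)
    (he : ∀ᶠ z in 𝓝 p, h z = h p) : ∀ z ∈ U, h z = h p :=
  AnalyticOnNhd.eqOn_of_preconnected_of_eventuallyEq
    (fun z hz ↦ _root_.HarmonicAt.analyticAt (hh z hz)) (analyticOnNhd_const (v := h p)) hU hp he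

theorem InnerProductSpace.HarmonicOnNhd.le_of_forall_frontier_le {h : ℂ → ℝ} {U : Set ℂ} {c : ℝ}
    (hh : HarmonicOnNhd h U) (hU : IsOpen U) (hUc : IsPreconnected U) (hUb : Bornology.IsBounded U)
    (hc : ContinuousOn h (closure U)) (hf : ∀ z ∈ frontier U, h z ≤ c) {z : ℂ} (hz : z ∈ U) :
    h z ≤ c := by
  obtain ⟨w, hw, hmax⟩ := hUb.isCompact_closure.exists_isMaxOn ⟨z, subset_closure hz⟩ hc
  refine (hmax (subset_closure hz)).trans ?_
  by_cases hwU : w ∈ U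
  · have heq := hh.eqOn_const_of_eventually_eq hUc hwU ((hh w hwU).eventually_eq_of_isLocalMax
      (hmax.isLocalMax (mem_of_superset (hU.mem_nhds hwU) subset_closure)))
    obtain ⟨y, hy⟩ : (frontier U).Nonempty := by
      refine nonempty_frontier_iff.2 ⟨⟨w, hwU⟩, ?_⟩
      rintro rfl
      exact NormedSpace.unbounded_univ ℝ ℂ hUb
    have : EqOn h (fun _ ↦ h w) (closure U) :=
      EqOn.of_subset_closure heq hc continuousOn_const subset_closure subset_rfl
    exact (this (frontier_subset_closure hy)).symm.le.trans (hf y hy)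
  · exact hf w ⟨hw, by rwa [hU.interior_eq]⟩

/-- Near a critical point, a nonconstant harmonic function changes sign at least four times
around small circles. -/
theorem InnerProductSpace.HarmonicAt.exists_sectors {h : ℂ → ℝ} {p : ℂ}
    (hh : HarmonicAt h p) (hd : fderiv ℝ h p = 0) (hne : ¬ ∀ᶠ z in 𝓝 p, h z = h p) :
    ∃ n : ℕ, 2 ≤ n ∧ ∃ θ r : ℝ, 0 < r ∧ ∀ j : ℕ, j < 4 → ∀ x ∈ Ioc 0 r,
      0 < (-1) ^ j * (h (p + x * exp ((θ + j * (Real.pi / n) : ℝ) * I)) - h p) := by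
  obtain ⟨g, hg, hgh⟩ := hh.exists_analyticAt_re_eq
  have hg0 : deriv g p = 0 := by
    have h1 : HasFDerivAt (fun z ↦ (g z).re) _ p :=
      reCLM.hasFDerivAt.comp p (hg.differentiableAt.hasDerivAt.hasFDerivAt.restrictScalars ℝ)
    have h2 := h1.fderiv
    rw [hgh.fderiv_eq, hd] at h2
    have e1 := DFunLike.congr_fun h2 1
    have e2 := DFunLike.congr_fun h2 I
    simp at e1 e2
    exact Complex.ext (by simpa using e1.symm) (by simpa using e2)
  have hnc : ¬ ∀ᶠ z in 𝓝 p, g z - g p = 0 := by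
    contrapose! hne
    filter_upwards [hne, hgh] with z hz hz'
    rw [← hz', ← hgh.eq_of_nhds, sub_eq_zero.1 hz]
  obtain ⟨n, k, hk, hk0, hgk⟩ :=
    (hg.sub analyticAt_const).exists_eventuallyEq_pow_smul_nonzero_iff.2 hnc
  replace hgk : ∀ᶠ z in 𝓝 p, g z - g p = (z - p) ^ n * k z := hgk
  have hn : 2 ≤ n := by
    by_contra! hn
    interval_cases n
    · have := hgk.self_of_nhds
      simp at this
      exact hk0 this.symm
    · have h1 : HasDerivAt (fun z ↦ (z - p) ^ 1 * k z) (k p) p := by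
        simpa using ((hasDerivAt_id' p).sub_const p).fun_mul hk.differentiableAt.hasDerivAt
      have h2 := (h1.congr_of_eventuallyEq hgk).deriv
      rw [deriv_sub_const, hg0] at h2
      exact hk0 h2.symm
  have hn0 : (n : ℝ) ≠ 0 := by positivity
  refine ⟨n, hn, -arg (k p) / n, ?_⟩
  set θ : ℕ → ℝ := fun j ↦ -arg (k p) / n + j * (Real.pi / n) with hθ
  have hexp : ∀ j : ℕ, exp (θ j * I) ^ n * k p = (-1) ^ j * ‖k p‖ := by
    intro j
    nth_rw 1 [← norm_mul_exp_arg_mul_I (k p)]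
    rw [← Complex.exp_nat_mul, mul_left_comm, ← exp_add, mul_comm]
    congr 1
    rw [← exp_pi_mul_I, ← Complex.exp_nat_mul]
    congr 1
    have hn0' : (n : ℂ) ≠ 0 := by exact_mod_cast hn0
    simp only [hθ]
    push_cast
    field_simp
    ring
  have hev : ∀ j : ℕ, ∀ᶠ x : ℝ in 𝓝[>] 0,
      0 < (-1) ^ j * (h (p + x * exp (θ j * I)) - h p) := by
    intro j
    have ht : Tendsto (fun x : ℝ ↦ p + x * exp (θ j * I)) (𝓝 0) (𝓝 p) := by
      have : Continuous (fun x : ℝ ↦ p + x * exp (θ j * I)) := by fun_prop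
      simpa using this.tendsto 0
    have hpos : ∀ᶠ x : ℝ in 𝓝 0,
        0 < ((-1) ^ j * (exp (θ j * I) ^ n * k (p + x * exp (θ j * I)))).re := by
      have hc : Tendsto (fun x : ℝ ↦ ((-1) ^ j * (exp (θ j * I) ^ n *
          k (p + x * exp (θ j * I)))).re) (𝓝 0) (𝓝 ‖k p‖) := by
        have h1 := (continuous_re.tendsto _).comp (((hk.continuousAt.tendsto.comp ht).const_mul
          (exp (θ j * I) ^ n)).const_mul ((-1) ^ j))
        rw [hexp, ← mul_assoc, ← mul_pow] at h1
        have e : ((-1 * -1) ^ j * (‖k p‖ : ℂ)).re = ‖k p‖ := by simp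
        rwa [e] at h1
      exact hc.eventually (lt_mem_nhds (norm_pos_iff.2 hk0))
    filter_upwards [self_mem_nhdsWithin, nhdsWithin_le_nhds hpos,
      nhdsWithin_le_nhds (ht.eventually hgk), nhdsWithin_le_nhds (ht.eventually hgh)]
      with x hx h1 h2 h3
    have e : h (p + x * exp (θ j * I)) - h p =
        x ^ n * (exp (θ j * I) ^ n * k (p + x * exp (θ j * I))).re := by
      rw [← h3, ← hgh.eq_of_nhds, ← sub_re, h2, add_sub_cancel_left, mul_pow, mul_assoc,
        ← ofReal_pow, re_ofReal_mul]
    have e' : ((-1) ^ j * (exp (θ j * I) ^ n * k (p + x * exp (θ j * I)))).re =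
        (-1) ^ j * (exp (θ j * I) ^ n * k (p + x * exp (θ j * I))).re := by
      rw [← re_ofReal_mul]; push_cast; rfl
    rw [e, mul_left_comm, ← e']
    exact mul_pos (pow_pos hx n) h1
  have hall : ∀ᶠ x : ℝ in 𝓝[>] 0, ∀ j ∈ Finset.range 4,
      0 < (-1) ^ j * (h (p + x * exp (θ j * I)) - h p) :=
    (Finset.eventually_all _).2 fun j _ ↦ hev j
  obtain ⟨r, hr, hr'⟩ := mem_nhdsGT_iff_exists_Ioc_subset.1 hall
  exact ⟨r, hr, fun j hj x hx ↦ hr' hx j (Finset.mem_range.2 hj)⟩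

end HarmonicPlane

section CriticalPoints

open Complex InnerProductSpace

theorem InnerProductSpace.HarmonicOnNhd.exists_mem_frontier_connectedComponentIn {V : Set ℂ}
    (hV : IsCompact V) {h : ℂ → ℝ} (hc : Continuous h) (hh : HarmonicOnNhd h (interior V)) {c : ℝ}
    {x : ℂ} (hx : x ∈ V) (hcx : c < h x) :
    ∃ y ∈ frontier V, c < h y ∧ y ∈ connectedComponentIn {z | c < h z} x := by
  by_contra! H
  have hP : IsOpen {z | c < h z} := isOpen_lt continuous_const hc
  set C := connectedComponentIn {z | c < h z} x with hC
  have hCo : IsOpen C := hP.connectedComponentIn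
  have hCP : C ⊆ {z | c < h z} := connectedComponentIn_subset _ _
  have hxC : x ∈ C := mem_connectedComponentIn hcx
  have hCc : IsPreconnected C := isPreconnected_connectedComponentIn
  have hCV : C ⊆ interior V := by
    refine hCc.subset_left_of_subset_union isOpen_interior hV.isClosed.isOpen_compl
      (disjoint_compl_right.mono_left interior_subset) ?_ ⟨x, hxC, ?_⟩
    · intro y hy
      by_cases hyV : y ∈ V
      · left
        by_contra hyi
        exact H y ⟨subset_closure hyV, hyi⟩ (hCP hy) hy
      · exact Or.inr hyV
    · by_contra hxi
      exact H x ⟨subset_closure hx, hxi⟩ hcx hxC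
  refine hcx.not_ge (HarmonicOnNhd.le_of_forall_frontier_le (fun z hz ↦ hh z (hCV hz)) hCo hCc
    (hV.isBounded.subset (hCV.trans interior_subset)) hc.continuousOn (fun z hz ↦ ?_) hxC)
  by_contra! hcz
  obtain ⟨y, hy1, hy2⟩ := mem_closure_iff.1 hz.1 _ hP.connectedComponentIn
    (mem_connectedComponentIn hcz)
  have : z ∈ C := by
    rw [hC, connectedComponentIn_eq hy2, ← connectedComponentIn_eq hy1]
    exact mem_connectedComponentIn hcz
  exact hz.2 (by rwa [hCo.interior_eq])

theorem InnerProductSpace.HarmonicOnNhd.joinedIn_of_isPreconnected {V : Set ℂ}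
    (hV : IsCompact V) {h : ℂ → ℝ} (hc : Continuous h) (hh : HarmonicOnNhd h (interior V)) {c : ℝ}
    (hpre : IsPreconnected (frontier V ∩ {z | c < h z})) {x y : ℂ} (hx : x ∈ V) (hy : y ∈ V)
    (hcx : c < h x) (hcy : c < h y) : JoinedIn {z | c < h z} x y := by
  have hP : IsOpen {z | c < h z} := isOpen_lt continuous_const hc
  obtain ⟨x', hx'V, hcx', hx'⟩ :=
    hh.exists_mem_frontier_connectedComponentIn hV hc hx hcx
  obtain ⟨y', hy'V, hcy', hy'⟩ :=
    hh.exists_mem_frontier_connectedComponentIn hV hc hy hcy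
  have h1 : y' ∈ connectedComponentIn {z | c < h z} x' :=
    hpre.subset_connectedComponentIn ⟨hx'V, hcx'⟩ inter_subset_right ⟨hy'V, hcy'⟩
  have h2 : y ∈ connectedComponentIn {z | c < h z} x := by
    rw [connectedComponentIn_eq hx', connectedComponentIn_eq h1, ← connectedComponentIn_eq hy']
    exact mem_connectedComponentIn hcy
  have hco : IsConnected (connectedComponentIn {z | c < h z} x) :=
    isConnected_connectedComponentIn_iff.2 hcx
  exact ((hP.connectedComponentIn.isConnected_iff_isPathConnected.1 hco).joinedIn x
    (mem_connectedComponentIn hcx) y h2).mono (connectedComponentIn_subset _ _)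

theorem InnerProductSpace.HarmonicOnNhd.fderiv_ne_zero_of_continuous {V : Set ℂ}
    (hV : IsCompact V) {h : ℂ → ℝ} (hc : Continuous h) (hh : HarmonicOnNhd h (interior V)) {p : ℂ}
    (hp : p ∈ interior V) (hne : ¬ ∀ᶠ z in 𝓝 p, h z = h p)
    (hgt : IsPreconnected (frontier V ∩ {z | h p < h z}))
    (hlt : IsPreconnected (frontier V ∩ {z | h z < h p})) : fderiv ℝ h p ≠ 0 := by
  intro hd
  obtain ⟨n, hn, θ, r, hr, hsec⟩ := (hh p hp).exists_sectors hd hne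
  obtain ⟨ε, hε, hεV⟩ := Metric.isOpen_iff.1 isOpen_interior p hp
  set ρ := min r (ε / 2)
  have hρ : 0 < ρ := lt_min hr (half_pos hε)
  have hnorm (t : ℝ) : ‖exp (t * I)‖ = 1 := norm_exp_ofReal_mul_I t
  set e : ℕ → ℂ := fun j ↦ ρ * exp ((θ + j * (Real.pi / n) : ℝ) * I) with he
  have heV (j : ℕ) : p + e j ∈ V := by
    refine interior_subset (hεV ?_)
    rw [Metric.mem_ball, dist_eq_norm, add_sub_cancel_left, he, norm_mul, hnorm, mul_one, norm_real,
      Real.norm_of_nonneg hρ.le]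
    exact (min_le_right _ _).trans_lt (half_lt_self hε)
  have hray (j : ℕ) (hj : j < 4) (x : unitInterval) (hx : (x : ℝ) ≠ 0) :
      0 < (-1) ^ j * (h (p + (x : ℝ) * e j) - h p) := by
    have hx0 : 0 < (x : ℝ) := lt_of_le_of_ne x.2.1 hx.symm
    have := hsec j hj ((x : ℝ) * ρ) ⟨mul_pos hx0 hρ,
      (mul_le_of_le_one_left hρ.le x.2.2).trans (min_le_left _ _)⟩
    rw [he, ← mul_assoc, ← ofReal_mul]
    exact this
  have hray1 (j : ℕ) (hj : j < 4) : 0 < (-1) ^ j * (h (p + e j) - h p) := by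
    simpa using hray j hj 1 (by simp)
  obtain ⟨α, hα⟩ := hh.joinedIn_of_isPreconnected hV hc hgt (heV 0) (heV 2)
    (by simpa using hray1 0 (by simp)) (by simpa using hray1 2 (by simp))
  obtain ⟨β, hβ⟩ := HarmonicOnNhd.joinedIn_of_isPreconnected (h := fun z ↦ - h z) (c := - h p) hV
    hc.neg (fun z hz ↦ (hh z hz).neg) (by simpa only [neg_lt_neg_iff] using hlt) (heV 1) (heV 3)
    (by simpa using hray1 1 (by simp)) (by
      have := hray1 3 (by simp)
      norm_num at this
      simpa using this)
  simp only [mem_ofPred_eq, neg_lt_neg_iff] at hα hβ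
  have hsub : Continuous fun z : ℂ ↦ z - p := by fun_prop
  have hcast (j : ℕ) : e j = (p + e j) - p := by ring
  have hpi := Real.pi_pos
  have hn0 : (0 : ℝ) < n := by positivity
  have hd0 : 0 < Real.pi / n := by positivity
  have hd1 : 3 * (Real.pi / n) < 2 * Real.pi := by
    have : (2 : ℝ) ≤ n := by exact_mod_cast hn
    rw [← mul_div_assoc, div_lt_iff₀ hn0]
    nlinarith
  have key := exists_eq_of_interleaved hρ (θ₁ := θ + (0 : ℕ) * (Real.pi / n))
    (θ₂ := θ + (1 : ℕ) * (Real.pi / n)) (θ₃ := θ + (2 : ℕ) * (Real.pi / n))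
    (θ₄ := θ + (3 : ℕ) * (Real.pi / n)) (by push_cast; linarith) (by push_cast; linarith)
    (by push_cast; linarith) (by push_cast; linarith)
    ((α.map hsub).cast (hcast 0) (hcast 2)) ((β.map hsub).cast (hcast 1) (hcast 3))
  have hαray (j : ℕ) (hj : j < 4) (hodd : Odd j) (s x : unitInterval) :
      α s - p ≠ (x : ℝ) * e j := by
    intro hs
    have h1 := hα s
    rw [sub_eq_iff_eq_add'.1 hs] at h1
    rcases eq_or_ne (x : ℝ) 0 with hx | hx
    · simp [hx] at h1
    · have := hray j hj x hx
      rw [hodd.neg_one_pow] at this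
      linarith
  have hβray (j : ℕ) (hj : j < 4) (hev : Even j) (s x : unitInterval) :
      β s - p ≠ (x : ℝ) * e j := by
    intro hs
    have h1 := hβ s
    rw [sub_eq_iff_eq_add'.1 hs] at h1
    rcases eq_or_ne (x : ℝ) 0 with hx | hx
    · simp [hx] at h1
    · have := hray j hj x hx
      rw [hev.neg_one_pow] at this
      linarith
  obtain ⟨s, t, hst⟩ := key (hαray 1 (by simp) (by decide)) (hαray 3 (by simp) (by decide))
    (hβray 0 (by simp) (by decide)) (hβray 2 (by simp) (by decide))
  have : α s = β t := sub_left_injective hst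
  exact lt_asymm (hα s) (this ▸ hβ t)

/-- A nonconstant harmonic function whose strict super- and sublevel sets at `p` cut the
boundary in connected pieces has no critical point at `p`. -/
theorem InnerProductSpace.HarmonicOnNhd.fderiv_ne_zero {V : Set ℂ} (hV : IsCompact V)
    (hVi : IsPreconnected (interior V)) (hVd : V ⊆ closure (interior V)) {h : ℂ → ℝ}
    (hc : ContinuousOn h V) (hh : HarmonicOnNhd h (interior V)) {p : ℂ}
    (hp : p ∈ interior V) (hne : ∃ x ∈ V, h x ≠ h p)
    (hgt : IsPreconnected (frontier V ∩ {z | h p < h z}))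
    (hlt : IsPreconnected (frontier V ∩ {z | h z < h p})) : fderiv ℝ h p ≠ 0 := by
  obtain ⟨H, hH⟩ := ContinuousMap.exists_restrict_eq hV.isClosed ⟨V.domRestrict h, hc.domRestrict⟩
  have hHh : EqOn H h V := fun z hz ↦ DFunLike.congr_fun hH ⟨z, hz⟩
  have hfr : frontier V ⊆ V := hV.isClosed.frontier_subset
  have hloc {z : ℂ} (hz : z ∈ interior V) : H =ᶠ[𝓝 z] h :=
    hHh.eventuallyEq_of_mem (mem_interior_iff_mem_nhds.1 hz)
  have hpH := hHh (interior_subset hp)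
  rw [← (hloc hp).fderiv_eq]
  refine HarmonicOnNhd.fderiv_ne_zero_of_continuous hV H.continuous
    (fun z hz ↦ (harmonicAt_congr_nhds (hloc hz)).2 (hh z hz)) hp (fun hev ↦ ?_) ?_ ?_
  · obtain ⟨x, hx, hxp⟩ := hne
    have heq : ∀ z ∈ interior V, h z = h p := hh.eqOn_const_of_eventually_eq hVi hp (by
      filter_upwards [hev, hloc hp] with z h1 h2
      rw [← h2, h1, hpH])
    exact hxp (EqOn.of_subset_closure heq hc continuousOn_const interior_subset hVd hx)
  · convert hgt using 1
    ext z
    exact and_congr_right fun hz ↦ by simp [hpH, hHh (hfr hz)]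
  · convert hlt using 1
    ext z
    exact and_congr_right fun hz ↦ by simp [hpH, hHh (hfr hz)]

end CriticalPoints

section ConvexBoundary

variable {E : Type*} [NormedAddCommGroup E] [NormedSpace ℝ E]

/-- An open half-plane through an interior point of a bounded convex set meets the boundary
in a connected set. -/
theorem Convex.isPreconnected_frontier_inter_lt {W : Set E} (hW : Convex ℝ W)
    (hb : Bornology.IsBounded W) {w : E} (hw : w ∈ interior W) (ℓ : StrongDual ℝ E) :
    IsPreconnected (frontier W ∩ {z | ℓ w < ℓ z}) := by
  set S : Set E := (fun d ↦ w + d) ⁻¹' W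
  have hS : Convex ℝ S := hW.translate_preimage_right w
  have hS0 : S ∈ 𝓝 0 := by
    have : ContinuousAt (fun d ↦ w + d) 0 := by fun_prop
    exact this.preimage_mem_nhds (by simpa using mem_interior_iff_mem_nhds.1 hw)
  have hSb : Bornology.IsVonNBounded ℝ S := by
    rw [NormedSpace.isVonNBounded_iff]
    refine (hb.vadd (-w)).subset fun d hd ↦ ⟨w + d, hd, ?_⟩
    simp [vadd_eq_add]
  have hfr (d : E) : gauge S d = 1 ↔ w + d ∈ frontier W := by
    rw [gauge_eq_one_iff_mem_frontier hS hS0]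
    exact Set.ext_iff.1 ((Homeomorph.addLeft w).preimage_frontier W).symm d
  have hpos {d : E} (hd : 0 < ℓ d) : 0 < gauge S d := by
    refine (gauge_pos (absorbent_nhds_zero hS0) hSb).2 ?_
    rintro rfl
    simp at hd
  have himage : frontier W ∩ {z | ℓ w < ℓ z} =
      (fun d ↦ w + (gauge S d)⁻¹ • d) '' {d | 0 < ℓ d} := by
    ext z
    constructor
    · rintro ⟨hz, hlt⟩
      refine ⟨z - w, by simpa using hlt, ?_⟩
      simp [(hfr (z - w)).2 (by simpa using hz)]
    · rintro ⟨d, hd, rfl⟩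
      have hg := hpos hd
      refine ⟨(hfr _).1 ?_, ?_⟩
      · rw [gauge_smul_of_nonneg (inv_nonneg.2 hg.le), smul_eq_mul, inv_mul_cancel₀ hg.ne']
      · have := mul_pos (inv_pos.2 hg) hd
        simpa using this
  rw [himage]
  refine (convex_halfSpace_gt ℓ.isLinear 0).isPreconnected.image _ ?_
  exact continuousOn_const.add (((continuous_gauge hS hS0).continuousOn.inv₀
    fun d hd ↦ (hpos hd).ne').smul continuousOn_id)

theorem IsCompact.exists_mem_frontier_lt {W : Set E} (hW : IsCompact W) {w : E}
    (hw : w ∈ interior W) {ℓ : StrongDual ℝ E} (hℓ : ℓ ≠ 0) : ∃ z ∈ frontier W, ℓ w < ℓ z := by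
  have hmax {y : E} (hy : y ∈ interior W) : ¬ IsMaxOn ℓ W y := fun h ↦ by
    have := (h.isLocalMax (mem_interior_iff_mem_nhds.1 hy)).fderiv_eq_zero
    exact hℓ (by simpa using this)
  obtain ⟨z, hz, hzmax⟩ := hW.exists_isMaxOn ⟨w, interior_subset hw⟩ ℓ.continuous.continuousOn
  refine ⟨z, ⟨subset_closure hz, fun hz' ↦ hmax hz' hzmax⟩, ?_⟩
  by_contra! h
  exact hmax hw fun y hy ↦ (hzmax hy).trans h

end ConvexBoundary

theorem IsPreconnected.inter_preimage_of_isCompact {X Y : Type*} [TopologicalSpace X]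
    [TopologicalSpace Y] [T2Space Y] {K : Set X} (hK : IsCompact K) {f : X → Y}
    (hf : ContinuousOn f K) (hi : InjOn f K) {T : Set Y} (hT : IsPreconnected T)
    (hTK : T ⊆ f '' K) : IsPreconnected (K ∩ f ⁻¹' T) := by
  have : CompactSpace K := isCompact_iff_compactSpace.1 hK
  have h := hT.preimage_of_isClosedMap (f := K.domRestrict f) (injOn_iff_injective.1 hi)
    hf.domRestrict.isClosedMap (by rwa [range_domRestrict])
  convert h.image _ continuous_subtype_val.continuousOn
  exact (Subtype.image_preimage_coe K (f ⁻¹' T)).symm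

theorem IsCoveringMap.bijective_of_simplyConnectedSpace {E X : Type*} [TopologicalSpace E]
    [TopologicalSpace X] [ConnectedSpace E] [SimplyConnectedSpace X]
    [LocallyPathConnectedSpace X] {p : E → X} (hp : IsCoveringMap p) : Function.Bijective p := by
  obtain ⟨e⟩ : Nonempty E := inferInstance
  obtain ⟨s, ⟨hse, hps⟩, -⟩ := hp.existsUnique_continuousMap_lifts (ContinuousMap.id X) (p e) e rfl
  have hsp : s ∘ p = id := hp.eq_of_comp_eq (s.continuous.comp hp.continuous) continuous_id
    (by rw [← Function.comp_assoc, hps]; rfl) e hse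
  exact ⟨Function.LeftInverse.injective (congr_fun hsp),
    Function.RightInverse.surjective (congr_fun hps)⟩

/-- A continuous map on a compact set whose interior is mapped to `U` and whose frontier is mapped
to the complement of `U` is a bijection onto `U` as soon as it is a local homeomorphism. -/
theorem IsLocalHomeomorphOn.bijOn_interior {X Y : Type*} [TopologicalSpace X] [TopologicalSpace Y]
    [T2Space X] [T2Space Y] {V : Set X} (hV : IsCompact V) (hVi : IsConnected (interior V))
    {U : Set Y} [SimplyConnectedSpace U] [LocallyPathConnectedSpace U] {f : X → Y}
    (hf : ContinuousOn f V) (hloc : IsLocalHomeomorphOn f (interior V))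
    (hint : MapsTo f (interior V) U) (hfr : MapsTo f (frontier V) Uᶜ) :
    BijOn f (interior V) U := by
  have : CompactSpace V := isCompact_iff_compactSpace.1 hV
  have hpre : V.domRestrict f ⁻¹' U = Subtype.val ⁻¹' interior V := by
    ext x
    refine ⟨fun hx ↦ ?_, fun hx ↦ hint hx⟩
    by_contra hxi
    exact hfr ⟨subset_closure x.2, hxi⟩ hx
  have hl : IsLocalHomeomorphOn (V.domRestrict f) (V.domRestrict f ⁻¹' U) := by
    let ι : interior V → V := inclusion interior_subset
    have hι : IsOpenEmbedding ι :=
      ⟨.inclusion _, by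
        rw [range_inclusion]; exact isOpen_interior.preimage continuous_subtype_val⟩
    have h1 : IsLocalHomeomorphOn (V.domRestrict f ∘ ι) univ :=
      hloc.comp (isOpen_interior.isOpenEmbedding_subtypeVal.isLocalHomeomorph.isLocalHomeomorphOn)
        fun x _ ↦ x.2
    rw [hpre]
    convert h1.of_comp_right hι.isLocalHomeomorph.isLocalHomeomorphOn
    ext x
    exact ⟨fun hx ↦ ⟨⟨x, hx⟩, mem_univ _, rfl⟩, by rintro ⟨y, -, rfl⟩; exact y.2⟩
  have hcov := (IsCoveringMapOn.of_isLocalHomeomorphOn hf.domRestrict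
    hl).isCoveringMap_restrictPreimage
  have : ConnectedSpace (V.domRestrict f ⁻¹' U) := by
    rw [← isConnected_iff_connectedSpace, hpre]
    refine ⟨?_, ?_⟩
    · obtain ⟨x, hx⟩ := hVi.nonempty
      exact ⟨⟨x, interior_subset hx⟩, hx⟩
    · rw [← IsInducing.subtypeVal.isPreconnected_image, Subtype.image_preimage_coe,
        inter_eq_right.2 interior_subset]
      exact hVi.isPreconnected
  obtain ⟨hinj, hsurj⟩ := hcov.bijective_of_simplyConnectedSpace
  refine ⟨hint, fun x hx y hy hxy ↦ ?_, fun z hz ↦ ?_⟩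
  · have := @hinj ⟨⟨x, interior_subset hx⟩, hint hx⟩ ⟨⟨y, interior_subset hy⟩, hint hy⟩
      (Subtype.ext hxy)
    exact congr_arg (fun a ↦ a.1.1) this
  · obtain ⟨⟨x, hx⟩, hxz⟩ := hsurj ⟨z, hz⟩
    exact ⟨x, hpre.subset hx, congr_arg Subtype.val hxz⟩

section HarmonicMaps

open Complex InnerProductSpace

theorem HarmonicOn2.harmonicOnNhd_comp_equivRealProd {u : ℝ × ℝ → ℝ} {U : Set (ℝ × ℝ)}
    (hu : HarmonicOn2 u U) (hU : IsOpen U) :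
    HarmonicOnNhd (u ∘ equivRealProdCLM) (equivRealProdCLM ⁻¹' U) := by
  intro z hz
  have hcd : ∀ y ∈ U, ContDiffAt ℝ 2 u y := fun y hy ↦ hu.1.contDiffAt (hU.mem_nhds hy)
  have hcd' : ∀ y ∈ equivRealProdCLM ⁻¹' U, ContDiffAt ℝ 2 (u ∘ equivRealProdCLM) y :=
    fun y hy ↦ (hcd _ hy).comp y equivRealProdCLM.contDiff.contDiffAt
  refine ⟨hcd' z hz, ?_⟩
  filter_upwards [(hU.preimage equivRealProdCLM.continuous).mem_nhds hz] with y hy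
  have hsecond (a : ℂ) : fderiv ℝ (fderiv ℝ (u ∘ equivRealProdCLM)) y a a =
      fderiv ℝ (fun q ↦ fderiv ℝ u q (equivRealProdCLM a)) (equivRealProdCLM y)
        (equivRealProdCLM a) := by
    have h1 : DifferentiableAt ℝ (fderiv ℝ (u ∘ equivRealProdCLM)) y :=
      ((hcd' y hy).fderiv_right (m := 1) (by norm_num)).differentiableAt (by norm_num)
    have h2 : fderiv ℝ (fun z ↦ fderiv ℝ (u ∘ equivRealProdCLM) z a) y a =
        fderiv ℝ (fderiv ℝ (u ∘ equivRealProdCLM)) y a a := by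
      rw [fderiv_clm_apply h1 (differentiableAt_const a)]
      simp
    have h3 : (fun z ↦ fderiv ℝ (u ∘ equivRealProdCLM) z a) =
        (fun q ↦ fderiv ℝ u q (equivRealProdCLM a)) ∘ equivRealProdCLM := by
      ext z
      rw [ContinuousLinearEquiv.comp_right_fderiv]
      rfl
    rw [← h2, h3, ContinuousLinearEquiv.comp_right_fderiv]
    rfl
  rw [laplacian_eq_iteratedFDeriv_complexPlane]
  simp only [iteratedFDeriv_two_apply, Matrix.cons_val_zero, Matrix.cons_val_one, hsecond]
  simpa [lap2] using hu.2 _ hy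

variable {V : Set ℂ} {W : Set (ℝ × ℝ)} {G : ℂ → ℝ × ℝ}

theorem ContinuousLinearMap.harmonicOnNhd_comp {U : Set ℂ}
    (hu : HarmonicOnNhd (fun z ↦ (G z).1) U) (hv : HarmonicOnNhd (fun z ↦ (G z).2) U)
    (ℓ : StrongDual ℝ (ℝ × ℝ)) : HarmonicOnNhd (fun z ↦ ℓ (G z)) U := by
  convert! (hu.const_smul (c := ℓ (1, 0))).add (hv.const_smul (c := ℓ (0, 1))) using 1
  ext z
  have : G z = (G z).1 • ((1, 0) : ℝ × ℝ) + (G z).2 • ((0, 1) : ℝ × ℝ) := by ext <;> simp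
  conv_lhs => rw [this, map_add, map_smul, map_smul]
  simp [mul_comm]

/-- Hypotheses on a harmonic map from a compact plane set to a compact convex plane set which maps
the boundary bijectively to the boundary. -/
structure IsHarmonicBoundaryMap (V : Set ℂ) (W : Set (ℝ × ℝ)) (G : ℂ → ℝ × ℝ) : Prop where
  isCompact_source : IsCompact V
  isConnected_interior : IsConnected (interior V)
  subset_closure_interior : V ⊆ closure (interior V)
  isCompact_target : IsCompact W
  convex : Convex ℝ W
  nonempty_interior : (interior W).Nonempty
  continuousOn : ContinuousOn G V
  harmonic_fst : HarmonicOnNhd (fun z ↦ (G z).1) (interior V)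
  harmonic_snd : HarmonicOnNhd (fun z ↦ (G z).2) (interior V)
  bijOn_frontier : BijOn G (frontier V) (frontier W)

namespace IsHarmonicBoundaryMap

theorem mapsTo_interior (h : IsHarmonicBoundaryMap V W G) :
    MapsTo G (interior V) (interior W) := by
  intro p hp
  by_contra hpW
  obtain ⟨w, hw⟩ := h.nonempty_interior
  obtain ⟨ℓ, hℓ⟩ := geometric_hahn_banach_open_point h.convex.interior isOpen_interior hpW
  have hℓ0 : ℓ ≠ 0 := by
    rintro rfl
    simpa using hℓ w hw
  have hfr : frontier V ⊆ V := h.isCompact_source.isClosed.frontier_subset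
  have hc : ContinuousOn (fun z ↦ ℓ (G z)) V := ℓ.continuous.comp_continuousOn h.continuousOn
  have hh := ℓ.harmonicOnNhd_comp h.harmonic_fst h.harmonic_snd
  have hWle : ∀ z ∈ W, ℓ z ≤ ℓ (G p) := by
    rw [← h.isCompact_target.isClosed.closure_eq,
      ← h.convex.closure_interior_eq_closure_of_nonempty_interior ⟨w, hw⟩]
    exact fun z hz ↦ closure_minimal (fun z hz ↦ (hℓ z hz).le)
      (isClosed_le ℓ.continuous continuous_const) hz
  have hle : ∀ z ∈ interior V, ℓ (G z) ≤ ℓ (G p) := fun z hz ↦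
    hh.le_of_forall_frontier_le isOpen_interior h.isConnected_interior.isPreconnected
      (h.isCompact_source.isBounded.subset interior_subset)
      (hc.mono (closure_minimal interior_subset h.isCompact_source.isClosed))
      (fun z hz ↦ hWle _ (h.isCompact_target.isClosed.frontier_subset
        (h.bijOn_frontier.mapsTo (frontier_interior_subset hz)))) hz
  have heq := hh.eqOn_const_of_eventually_eq h.isConnected_interior.isPreconnected hp
    ((hh p hp).eventually_eq_of_isLocalMax
      (mem_of_superset (isOpen_interior.mem_nhds hp) hle))
  have heqV : EqOn (fun z ↦ ℓ (G z)) (fun _ ↦ ℓ (G p)) V :=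
    EqOn.of_subset_closure heq hc continuousOn_const interior_subset h.subset_closure_interior
  obtain ⟨a, ha, hwa⟩ := h.isCompact_target.exists_mem_frontier_lt hw (neg_ne_zero.2 hℓ0)
  obtain ⟨x, hx, rfl⟩ := h.bijOn_frontier.surjOn ha
  have h1 : ℓ (G x) = ℓ (G p) := heqV (hfr hx)
  have h2 := hℓ w hw
  simp only [neg_apply, neg_lt_neg_iff] at hwa
  linarith

theorem isPreconnected_frontier_inter (h : IsHarmonicBoundaryMap V W G) {p : ℂ}
    (hp : p ∈ interior V) (ℓ : StrongDual ℝ (ℝ × ℝ)) :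
    IsPreconnected (frontier V ∩ {z | ℓ (G p) < ℓ (G z)}) := by
  convert (h.convex.isPreconnected_frontier_inter_lt h.isCompact_target.isBounded
    (h.mapsTo_interior hp) ℓ).inter_preimage_of_isCompact
    (h.isCompact_source.of_isClosed_subset isClosed_frontier
      h.isCompact_source.isClosed.frontier_subset)
    (h.continuousOn.mono h.isCompact_source.isClosed.frontier_subset) h.bijOn_frontier.injOn
    (by rw [h.bijOn_frontier.image_eq]; exact inter_subset_left) using 1
  ext z
  exact ⟨fun hz ↦ ⟨hz.1, h.bijOn_frontier.mapsTo hz.1, hz.2⟩, fun hz ↦ ⟨hz.1, hz.2.2⟩⟩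

theorem fderiv_comp_ne_zero (h : IsHarmonicBoundaryMap V W G) {p : ℂ} (hp : p ∈ interior V)
    {ℓ : StrongDual ℝ (ℝ × ℝ)} (hℓ : ℓ ≠ 0) : fderiv ℝ (fun z ↦ ℓ (G z)) p ≠ 0 := by
  refine (ℓ.harmonicOnNhd_comp h.harmonic_fst h.harmonic_snd).fderiv_ne_zero h.isCompact_source
    h.isConnected_interior.isPreconnected h.subset_closure_interior
    (ℓ.continuous.comp_continuousOn h.continuousOn) hp ?_
    (h.isPreconnected_frontier_inter hp ℓ) ?_
  · obtain ⟨a, ha, hlt⟩ := h.isCompact_target.exists_mem_frontier_lt (h.mapsTo_interior hp) hℓ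
    obtain ⟨x, hx, rfl⟩ := h.bijOn_frontier.surjOn ha
    exact ⟨x, h.isCompact_source.isClosed.frontier_subset hx, hlt.ne'⟩
  · simpa using h.isPreconnected_frontier_inter hp (-ℓ)

theorem isLocalHomeomorphOn (h : IsHarmonicBoundaryMap V W G) :
    IsLocalHomeomorphOn G (interior V) := by
  intro p hp
  have hG : ContDiffAt ℝ 2 G p := (h.harmonic_fst p hp).1.prodMk (h.harmonic_snd p hp).1
  have hd : HasFDerivAt G (fderiv ℝ G p) p :=
    (hG.differentiableAt two_ne_zero).hasFDerivAt
  have hsurj : LinearMap.range (fderiv ℝ G p : ℂ →ₗ[ℝ] ℝ × ℝ) = ⊤ := by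
    by_contra hne
    obtain ⟨f, hf0, hf⟩ := Submodule.exists_le_ker_of_lt_top _ (lt_top_iff_ne_top.2 hne)
    refine h.fderiv_comp_ne_zero hp (ℓ := f.toContinuousLinearMap) (by simpa using hf0) ?_
    refine (f.toContinuousLinearMap.hasFDerivAt.comp p hd).fderiv.trans ?_
    exact ContinuousLinearMap.ext fun a ↦ hf ⟨a, rfl⟩
  have hfin : Module.finrank ℝ ℂ = Module.finrank ℝ (ℝ × ℝ) := by simp
  let e : ℂ ≃L[ℝ] ℝ × ℝ := (LinearEquiv.ofBijective (fderiv ℝ G p : ℂ →ₗ[ℝ] ℝ × ℝ)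
    ⟨(LinearMap.injective_iff_surjective_of_finrank_eq_finrank hfin).2
      (LinearMap.range_eq_top.1 hsurj), LinearMap.range_eq_top.1 hsurj⟩).toContinuousLinearEquiv
  have he : HasFDerivAt G (e : ℂ →L[ℝ] ℝ × ℝ) p := by
    convert hd using 1
    ext a <;> rfl
  exact ⟨hG.toOpenPartialHomeomorph G he two_ne_zero,
    hG.mem_toOpenPartialHomeomorph_source he two_ne_zero, rfl⟩

/-- The Radó–Kneser–Choquet theorem. -/
theorem bijOn (h : IsHarmonicBoundaryMap V W G) : BijOn G V W := by
  have hconv := h.convex.interior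
  have := hconv.contractibleSpace h.nonempty_interior
  have := hconv.locallyPathConnectedSpace
  have hint : BijOn G (interior V) (interior W) :=
    h.isLocalHomeomorphOn.bijOn_interior h.isCompact_source h.isConnected_interior h.continuousOn
      h.mapsTo_interior fun x hx ↦ (h.bijOn_frontier.mapsTo hx).2
  have hunion := hint.union h.bijOn_frontier ?_
  · rwa [← closure_eq_interior_union_frontier, ← closure_eq_interior_union_frontier,
      h.isCompact_source.isClosed.closure_eq, h.isCompact_target.isClosed.closure_eq] at hunion
  · refine injOn_union (disjoint_interior_frontier) |>.2
      ⟨hint.injOn, h.bijOn_frontier.injOn, fun x hx y hy hxy ↦ ?_⟩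
    exact (h.bijOn_frontier.mapsTo hy).2 (hxy ▸ h.mapsTo_interior hx)

end IsHarmonicBoundaryMap

end HarmonicMaps

theorem IsClosureOfSCRegion.isCompact {V : Set (ℝ × ℝ)} (hV : IsClosureOfSCRegion V) :
    IsCompact V := by
  obtain ⟨Ω, -, hb, -, -, rfl⟩ := hV
  exact hb.isCompact_closure

theorem IsClosureOfSCRegion.isConnected_interior {V : Set (ℝ × ℝ)} (hV : IsClosureOfSCRegion V) :
    IsConnected (interior V) := by
  obtain ⟨Ω, ho, -, -, hs, rfl⟩ := hV
  have : IsConnected Ω := isConnected_iff_connectedSpace.2 inferInstance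
  exact this.subset_closure (interior_maximal subset_closure ho) interior_subset

theorem IsClosureOfSCRegion.subset_closure_interior {V : Set (ℝ × ℝ)}
    (hV : IsClosureOfSCRegion V) : V ⊆ closure (interior V) := by
  obtain ⟨Ω, ho, -, -, -, rfl⟩ := hV
  exact closure_mono (interior_maximal subset_closure ho)

theorem OrientPresBoundaryHomeo.bijOn_frontier {F : ℝ × ℝ → ℝ × ℝ} {V W : Set (ℝ × ℝ)}
    (h : OrientPresBoundaryHomeo F V W) : BijOn F (frontier V) (frontier W) := by
  obtain ⟨γ, ⟨-, -, -, hγV, -⟩, -, -, hinj, hγW, -⟩ := h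
  rw [image_comp, hγV] at hγW
  rw [← hγW]
  refine InjOn.bijOn_image ?_
  rw [← hγV]
  exact hinj.image_of_comp

/-- A harmonic map `F = (u, v)` from the closure `V` of a bounded simply
connected open set to a convex such set `W`, continuous on `V`, continuously differentiable
and harmonic on the interior of `V`, whose restriction to `∂V` is an orientation-preserving
homeomorphism onto `∂W`, is a bijection from `V` onto `W`. -/
theorem harmonic_map_bijective (V W : Set (ℝ × ℝ))
    (hV : IsClosureOfSCRegion V) (hW : IsClosureOfSCRegion W) (hWconv : Convex ℝ W)
    (u v : ℝ × ℝ → ℝ)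
    (hu : ContinuousOn u V) (hv : ContinuousOn v V)
    (hu1 : ContDiffOn ℝ 1 u (interior V)) (hv1 : ContDiffOn ℝ 1 v (interior V))
    (huh : HarmonicOn2 u (interior V)) (hvh : HarmonicOn2 v (interior V))
    (hbd : OrientPresBoundaryHomeo (fun p => (u p, v p)) V W) :
    Set.BijOn (fun p => (u p, v p)) V W := by
  let φ := Complex.equivRealProdCLM
  let e := φ.toHomeomorph
  have hfr : frontier (φ ⁻¹' V) = φ ⁻¹' frontier V := (e.preimage_frontier V).symm
  have hint : interior (φ ⁻¹' V) = φ ⁻¹' interior V := (e.preimage_interior V).symm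
  have hφ {S : Set (ℝ × ℝ)} : BijOn φ (φ ⁻¹' S) S :=
    ⟨fun _ hx ↦ hx, φ.injective.injOn, fun y hy ↦ ⟨φ.symm y, by simpa using hy, by simp⟩⟩
  have key : IsHarmonicBoundaryMap (φ ⁻¹' V) W ((fun p ↦ (u p, v p)) ∘ φ) :=
    { isCompact_source := e.isCompact_preimage.2 hV.isCompact
      isConnected_interior := by
        rw [hint]
        exact e.isConnected_preimage.2 hV.isConnected_interior
      subset_closure_interior := by
        rw [hint]
        exact (preimage_mono hV.subset_closure_interior).trans (e.preimage_closure _).subset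
      isCompact_target := hW.isCompact
      convex := hWconv
      nonempty_interior := hW.isConnected_interior.nonempty
      continuousOn := (hu.prodMk hv).comp φ.continuous.continuousOn fun _ hx ↦ hx
      harmonic_fst := by
        rw [hint]
        exact huh.harmonicOnNhd_comp_equivRealProd isOpen_interior
      harmonic_snd := by
        rw [hint]
        exact hvh.harmonicOnNhd_comp_equivRealProd isOpen_interior
      bijOn_frontier := by
        rw [hfr]
        exact hbd.bijOn_frontier.comp hφ }
  exact (hφ (S := V)).image_eq ▸ (bijOn_comp_iff φ.injective.injOn).1 key.bijOn
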